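/- arXiv:0811.3024 — 2 statements merged into one kernel-verified Lean document; each statement's English description precedes it below -/
import Mathlib

section
/- (Proposition 1, uniqueness.) Let μ₀ be a Borel probability measure on ℝ and λ > 0. Suppose (ν_t)_{t≥0} is a family of Borel probability measures on ℝ with ν_0 = μ₀ such that for every Borel set A ⊆ ℝ the function t ↦ ν_t(A) is measurable and ν_t(A) = μ₀(A) + λ ∫₀ᵗ ( (ν_s ∗ ν_s)(A) − ν_s(A) ) ds for all t ≥ 0. Then for every t ≥ 0, ν_t equals the Wild sum Σ_{n≥1} e^{−λt}(1−e^{−λt})^{n−1} μ₀^{*n}. -/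
open MeasureTheory

/-- `n`-fold convolution power of a measure on `ℝ`: `convPow μ 0 = δ₀` and
`convPow μ (n+1) = (convPow μ n) ∗ μ`. In particular `convPow μ 1 = δ₀ ∗ μ = μ`. -/
noncomputable def convPow (μ : Measure ℝ) : ℕ → Measure ℝ
  | 0 => Measure.dirac 0
  | n + 1 => Measure.conv (convPow μ n) μ

/-- The Wild sum `Σ_{n≥1} e^{−λt}(1−e^{−λt})^{n−1} μ₀^{*n}`. -/
noncomputable def wildSum (μ₀ : Measure ℝ) (lam t : ℝ) : Measure ℝ :=
  Measure.sum fun n : ℕ =>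
    ENNReal.ofReal (Real.exp (-(lam * t)) * (1 - Real.exp (-(lam * t))) ^ n) •
      convPow μ₀ (n + 1)

open ProbabilityTheory Set

lemma Measure.real_bind_kernel_apply {α β : Type*} [MeasurableSpace α] [MeasurableSpace β]
    (m : Measure α) (κ : Kernel α β) [IsMarkovKernel κ] {A : Set β} (hA : MeasurableSet A) :
    (m.bind κ A).toReal = ∫ s, (κ s A).toReal ∂m := by
  rw [Measure.bind_apply hA κ.aemeasurable,
    integral_toReal (κ.measurable_coe hA).aemeasurable (by simp)]

lemma integrable_toReal_kernel_apply {α β : Type*} [MeasurableSpace α] [MeasurableSpace β]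
    (m : Measure α) [IsFiniteMeasure m] (κ : Kernel α β) [IsMarkovKernel κ] {A : Set β}
    (hA : MeasurableSet A) : Integrable (fun s => (κ s A).toReal) m := by
  refine (integrable_const (1 : ℝ)).mono'
    (κ.measurable_coe hA).ennreal_toReal.aestronglyMeasurable (.of_forall fun s => ?_)
  rw [Real.norm_of_nonneg ENNReal.toReal_nonneg]
  exact ENNReal.toReal_le_of_le_ofReal zero_le_one (by simpa using prob_le_one)

lemma Measure.integral_bind_kernel {α β : Type*} [MeasurableSpace α] [MeasurableSpace β]
    (m : Measure α) (κ : Kernel α β) {f : β → ℂ} (hf : Integrable f (m.bind κ)) :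
    ∫ x, f x ∂(m.bind κ) = ∫ s, ∫ x, f x ∂(κ s) ∂m := by
  have h := Kernel.integral_comp (η := κ) (κ := Kernel.const Unit m) (a := ()) (f := f)
    (by simpa [Kernel.comp_apply] using hf)
  simpa [Kernel.comp_apply] using h

lemma integrable_of_norm_le_one {β : Type*} [MeasurableSpace β] {f : β → ℂ}
    (hf : Measurable f) (hb : ∀ x, ‖f x‖ ≤ 1) (μ : Measure β) [IsFiniteMeasure μ] :
    Integrable f μ :=
  (integrable_const (1 : ℝ)).mono' hf.aestronglyMeasurable (.of_forall hb)

/-- An evolution identity tested on measurable sets extends to bounded measurable functions. -/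
lemma integral_eq_of_measure_evolution {β : Type*} [MeasurableSpace β] {P Q : Measure β}
    [IsProbabilityMeasure P] [IsProbabilityMeasure Q] (κ η : Kernel ℝ β) [IsMarkovKernel κ]
    [IsMarkovKernel η] {c t : ℝ} (hc : 0 ≤ c) (ht : 0 ≤ t)
    (h : ∀ A, MeasurableSet A → (P A).toReal =
      (Q A).toReal + c * ∫ s in (0 : ℝ)..t, (η s A).toReal - (κ s A).toReal)
    {f : β → ℂ} (hf : Measurable f) (hb : ∀ x, ‖f x‖ ≤ 1) :
    ∫ x, f x ∂P = ∫ x, f x ∂Q + c * ∫ s in (0 : ℝ)..t, (∫ x, f x ∂η s) - ∫ x, f x ∂κ s := by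
  set m : Measure ℝ := volume.restrict (Ioc 0 t)
  have hκη : P + c.toNNReal • m.bind κ = Q + c.toNNReal • m.bind η := by
    ext A hA
    rw [← ENNReal.toReal_eq_toReal_iff' (measure_ne_top _ _) (measure_ne_top _ _)]
    rw [Measure.add_apply, Measure.add_apply,
      ENNReal.toReal_add (measure_ne_top _ _) (measure_ne_top _ _),
      ENNReal.toReal_add (measure_ne_top _ _) (measure_ne_top _ _)]
    simp only [Measure.smul_apply, ENNReal.toReal_smul, Measure.real_bind_kernel_apply m _ hA]
    rw [h A hA, intervalIntegral.integral_of_le ht,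
      integral_sub (integrable_toReal_kernel_apply _ η hA) (integrable_toReal_kernel_apply _ κ hA)]
    simp only [NNReal.smul_def, Real.coe_toNNReal c hc, smul_eq_mul, m]
    ring
  have hi (μ : Measure β) [IsFiniteMeasure μ] : Integrable f μ := integrable_of_norm_le_one hf hb μ
  have hint (ζ : Kernel ℝ β) [IsMarkovKernel ζ] : Integrable (fun s => ∫ x, f x ∂ζ s) m :=
    (integrable_const (1 : ℝ)).mono' hf.stronglyMeasurable.integral_kernel.aestronglyMeasurable
      (.of_forall fun s => by
        simpa using norm_integral_le_of_norm_le_const (μ := ζ s) (.of_forall hb))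
  have key := congrArg (fun μ => ∫ x, f x ∂μ) hκη
  rw [integral_add_measure (hi _) (hi _), integral_add_measure (hi _) (hi _),
    integral_smul_nnreal_measure, integral_smul_nnreal_measure,
    Measure.integral_bind_kernel _ _ (hi _), Measure.integral_bind_kernel _ _ (hi _)] at key
  rw [intervalIntegral.integral_of_le ht, integral_sub (hint η) (hint κ)]
  simp only [NNReal.smul_def, Real.coe_toNNReal c hc, Complex.real_smul] at key
  linear_combination key

/-- Closed form of a bounded solution of the logistic integral equation. -/
lemma logistic_integral_eq_closed_form {c : ℝ} (hc : 0 ≤ c) {φ : ℝ → ℂ} {a : ℂ}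
    (hφ : Measurable φ) (hb : ∀ s, ‖φ s‖ ≤ 1)
    (h : ∀ t ≥ (0 : ℝ), φ t = a + c * ∫ s in (0 : ℝ)..t, φ s ^ 2 - φ s) {t : ℝ} (ht : 0 ≤ t) :
    φ t * (1 - (1 - Real.exp (-(c * t))) * a) = Real.exp (-(c * t)) * a := by
  set Φ : ℝ → ℂ := fun t => a + c * ∫ s in (0 : ℝ)..t, φ s ^ 2 - φ s with hΦ
  have hΦc : Continuous Φ := by
    refine continuous_const.add (continuous_const.mul ?_)
    refine intervalIntegral.continuous_primitive (fun x y => ?_) 0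
    refine (intervalIntegrable_const (c := (2 : ℝ))).mono_fun
      ((hφ.pow_const 2).sub hφ).aestronglyMeasurable (.of_forall fun s => ?_)
    calc ‖φ s ^ 2 - φ s‖ ≤ ‖φ s ^ 2‖ + ‖φ s‖ := norm_sub_le _ _
      _ ≤ 1 + 1 := by
        rw [norm_pow]
        exact add_le_add (pow_le_one₀ (norm_nonneg _) (hb s)) (hb s)
      _ = ‖(2 : ℝ)‖ := by norm_num
  set Ψ : ℝ → ℂ := fun t => a + c * ∫ s in (0 : ℝ)..t, Φ s ^ 2 - Φ s with hΨ
  have hΨd (s : ℝ) : HasDerivAt Ψ (c * (Φ s ^ 2 - Φ s)) s := by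
    have hcont : Continuous fun s => Φ s ^ 2 - Φ s := by fun_prop
    exact ((hcont.integral_hasStrictDerivAt 0 s).hasDerivAt.const_mul (c : ℂ)).const_add a
  have hΨφ : ∀ s ≥ (0 : ℝ), Ψ s = φ s := fun s hs => by
    rw [h s hs]
    simp only [hΨ]
    congr 2
    refine intervalIntegral.integral_congr fun r hr => ?_
    rw [uIcc_of_le hs] at hr
    simp only [hΦ, ← h r hr.1]
  set g : ℝ → ℂ := fun s =>
    Ψ s * (1 - (1 - (Real.exp (-(c * s)) : ℂ)) * a) - Real.exp (-(c * s)) * a with hg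
  have hed (s : ℝ) : HasDerivAt (fun s : ℝ => (Real.exp (-(c * s)) : ℂ))
      ((Real.exp (-(c * s)) * -(c * 1) : ℝ) : ℂ) s :=
    (((hasDerivAt_id s).const_mul c).neg.exp).ofReal_comp
  have hgd (s : ℝ) : HasDerivAt g (c * (Φ s ^ 2 - Φ s) *
      (1 - (1 - (Real.exp (-(c * s)) : ℂ)) * a) +
      Ψ s * -(-((Real.exp (-(c * s)) * -(c * 1) : ℝ) : ℂ) * a) -
      ((Real.exp (-(c * s)) * -(c * 1) : ℝ) : ℂ) * a) s :=
    ((hΨd s).mul ((((hed s).const_sub 1).mul_const a).const_sub 1)).sub ((hed s).mul_const a)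
  have hg0 : g t = 0 := by
    refine eq_zero_of_abs_deriv_le_mul_abs_self_of_eq_zero_right (K := c * 2) (a := 0) (b := t)
      (fun s _ => (hgd s).continuousAt.continuousWithinAt)
      (fun s _ => (hgd s).hasDerivWithinAt) ?_ (fun s hs => ?_) t ⟨ht, le_rfl⟩
    · simp [hg, hΨ]
    · have h1 : Φ s = φ s := (h s hs.1).symm
      have h2 : Ψ s = φ s := hΨφ s hs.1
      have : c * (Φ s ^ 2 - Φ s) * (1 - (1 - (Real.exp (-(c * s)) : ℂ)) * a) +
          Ψ s * -(-((Real.exp (-(c * s)) * -(c * 1) : ℝ) : ℂ) * a) -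
          ((Real.exp (-(c * s)) * -(c * 1) : ℝ) : ℂ) * a = (c * (φ s - 1)) * g s := by
        simp only [hg, h1, h2]
        push_cast
        ring
      rw [this, norm_mul]
      gcongr
      rw [norm_mul, Complex.norm_real, Real.norm_of_nonneg hc]
      gcongr
      calc ‖φ s - 1‖ ≤ ‖φ s‖ + ‖(1 : ℂ)‖ := norm_sub_le _ _
        _ ≤ 1 + 1 := by simpa using hb s
        _ = 2 := by norm_num
  rw [← hΨφ t ht]
  exact sub_eq_zero.mp hg0

instance isProbabilityMeasure_convPow (μ : Measure ℝ) [IsProbabilityMeasure μ] (n : ℕ) :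
    IsProbabilityMeasure (convPow μ n) := by
  induction n with
  | zero => exact Measure.dirac.isProbabilityMeasure
  | succ n ih => exact Measure.probabilitymeasure_of_probabilitymeasures_conv _ _

lemma charFun_convPow (μ : Measure ℝ) [IsProbabilityMeasure μ] (n : ℕ) (ξ : ℝ) :
    charFun (convPow μ n) ξ = charFun μ ξ ^ n := by
  induction n with
  | zero => simp [convPow]
  | succ n ih => rw [convPow, charFun_conv, ih, pow_succ]

section WildSum

variable {lam t : ℝ}

lemma one_sub_exp_neg_mem_Ico (hlam : 0 ≤ lam) (ht : 0 ≤ t) :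
    1 - Real.exp (-(lam * t)) ∈ Ico (0 : ℝ) 1 :=
  ⟨by simpa using mul_nonneg hlam ht, by simpa using Real.exp_pos _⟩

lemma isProbabilityMeasure_wildSum (μ₀ : Measure ℝ) [IsProbabilityMeasure μ₀]
    (hlam : 0 ≤ lam) (ht : 0 ≤ t) : IsProbabilityMeasure (wildSum μ₀ lam t) := by
  obtain ⟨h0, h1⟩ := one_sub_exp_neg_mem_Ico hlam ht
  have hs := (hasSum_geometric_of_lt_one h0 h1).mul_left (Real.exp (-(lam * t)))
  rw [sub_sub_cancel, mul_inv_cancel₀ (Real.exp_ne_zero _)] at hs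
  refine ⟨?_⟩
  simp only [wildSum, Measure.sum_apply _ MeasurableSet.univ, Measure.smul_apply, measure_univ,
    smul_eq_mul, mul_one]
  rw [← ENNReal.ofReal_tsum_of_nonneg (fun n => by positivity) hs.summable, hs.tsum_eq,
    ENNReal.ofReal_one]

lemma norm_one_sub_exp_neg_mul_lt_one (hlam : 0 ≤ lam) (ht : 0 ≤ t) {a : ℂ} (ha : ‖a‖ ≤ 1) :
    ‖(1 - (Real.exp (-(lam * t)) : ℂ)) * a‖ < 1 := by
  obtain ⟨h0, h1⟩ := one_sub_exp_neg_mem_Ico hlam ht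
  rw [norm_mul, ← Complex.ofReal_one, ← Complex.ofReal_sub, Complex.norm_real,
    Real.norm_of_nonneg h0]
  exact (mul_le_of_le_one_right h0 ha).trans_lt h1

lemma charFun_wildSum (μ₀ : Measure ℝ) [IsProbabilityMeasure μ₀]
    (hlam : 0 ≤ lam) (ht : 0 ≤ t) (ξ : ℝ) :
    charFun (wildSum μ₀ lam t) ξ = Real.exp (-(lam * t)) * charFun μ₀ ξ *
      (1 - (1 - (Real.exp (-(lam * t)) : ℂ)) * charFun μ₀ ξ)⁻¹ := by
  have := isProbabilityMeasure_wildSum μ₀ hlam ht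
  obtain ⟨h0, -⟩ := one_sub_exp_neg_mem_Ico hlam ht
  have hint : Integrable (fun x : ℝ => Complex.exp (ξ * x * Complex.I)) (wildSum μ₀ lam t) :=
    integrable_of_norm_le_one (by fun_prop)
      (fun x => by rw [← Complex.ofReal_mul, Complex.norm_exp_ofReal_mul_I]) _
  have hs := hasSum_integral_measure hint
  have hgeom := (hasSum_geometric_of_norm_lt_one
    (norm_one_sub_exp_neg_mul_lt_one hlam ht (norm_charFun_le_one (μ := μ₀) ξ))).mul_left
    (Real.exp (-(lam * t)) * charFun μ₀ ξ)
  rw [charFun_apply_real]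
  refine hs.unique (hgeom.congr_fun fun n => ?_)
  rw [integral_smul_measure, ← charFun_apply_real, charFun_convPow, mul_pow,
    ENNReal.toReal_ofReal (by positivity), Complex.real_smul]
  push_cast
  ring

end WildSum

/-- **Proposition 1, uniqueness.** Any measurable family of probability
measures starting at `μ₀` and satisfying the evolution equation
`ν_t(A) = μ₀(A) + λ ∫₀ᵗ ((ν_s ∗ ν_s)(A) − ν_s(A)) ds` coincides with the Wild sum. -/
theorem evolution_solution_eq_wildSum
    (μ₀ : Measure ℝ) [IsProbabilityMeasure μ₀] (lam : ℝ) (hlam : 0 < lam)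
    (ν : ℝ → Measure ℝ) (hprob : ∀ t ≥ (0 : ℝ), IsProbabilityMeasure (ν t))
    (hinit : ν 0 = μ₀)
    (hmeas : ∀ A : Set ℝ, MeasurableSet A → Measurable fun t : ℝ => (ν t) A)
    (heq : ∀ A : Set ℝ, MeasurableSet A → ∀ t ≥ (0 : ℝ),
      ((ν t) A).toReal =
        (μ₀ A).toReal +
          lam * ∫ s in (0 : ℝ)..t,
            ((Measure.conv (ν s) (ν s)) A).toReal - ((ν s) A).toReal) :
    ∀ t ≥ (0 : ℝ), ν t = wildSum μ₀ lam t := by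
  classical
  let κ : Kernel ℝ ℝ :=
    { toFun := fun s => if 0 ≤ s then ν s else μ₀
      measurable' := Measurable.ite measurableSet_Ici
        (Measure.measurable_of_measurable_coe _ hmeas) measurable_const }
  have hκν : ∀ s ≥ (0 : ℝ), κ s = ν s := fun s hs => if_pos hs
  have : IsMarkovKernel κ := ⟨fun s => by
    by_cases hs : 0 ≤ s
    · rw [hκν s hs]; exact hprob s hs
    · rw [show κ s = μ₀ from if_neg hs]; infer_instance⟩
  let η : Kernel ℝ ℝ := (κ ×ₖ κ).map (fun x : ℝ × ℝ => x.1 + x.2)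
  have hη (s : ℝ) : η s = Measure.conv (κ s) (κ s) := by
    rw [Kernel.map_apply _ (by fun_prop), Kernel.prod_apply, Measure.conv]
  have : IsMarkovKernel η := Kernel.IsMarkovKernel.map _ (by fun_prop)
  intro t ht
  have := isProbabilityMeasure_wildSum μ₀ hlam.le ht
  have hevol : ∀ ξ : ℝ, ∀ u ≥ (0 : ℝ), charFun (κ u) ξ = charFun μ₀ ξ +
      lam * ∫ s in (0 : ℝ)..u, charFun (κ s) ξ ^ 2 - charFun (κ s) ξ := by
    intro ξ u hu
    have h := integral_eq_of_measure_evolution (P := κ u) (Q := μ₀) κ η hlam.le hu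
      (fun A hA => by
        rw [hκν u hu, heq A hA u hu]
        congr 2
        refine intervalIntegral.integral_congr fun s hs => ?_
        rw [uIcc_of_le hu] at hs
        simp only [hη, hκν s hs.1])
      (f := fun x : ℝ => Complex.exp (ξ * x * Complex.I)) (by fun_prop)
      (fun x => by rw [← Complex.ofReal_mul, Complex.norm_exp_ofReal_mul_I])
    simpa only [← charFun_apply_real, hη, charFun_conv, ← pow_two] using h
  rw [← hκν t ht]
  refine Measure.ext_of_charFun (funext fun ξ => ?_)
  have hmeasφ : Measurable fun s => charFun (κ s) ξ := by
    simp only [charFun_apply_real]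
    exact (Measurable.stronglyMeasurable (by fun_prop)).integral_kernel.measurable
  have hclosed := logistic_integral_eq_closed_form hlam.le hmeasφ
    (fun s => norm_charFun_le_one ξ) (hevol ξ) ht
  have hne : 1 - (1 - (Real.exp (-(lam * t)) : ℂ)) * charFun μ₀ ξ ≠ 0 := fun h0 => by
    have h := norm_one_sub_exp_neg_mul_lt_one hlam.le ht (norm_charFun_le_one (μ := μ₀) ξ)
    rw [← sub_eq_zero.mp h0] at h
    simp at h
  rw [charFun_wildSum μ₀ hlam.le ht ξ, ← hclosed, mul_inv_cancel_right₀ hne]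
end

section
/- (Proposition 2.) Let μ₀ be a Borel probability measure on ℝ such that ∫ e^{s x} dμ₀(x) < ∞ for all s in some open neighborhood of 0 and ∫ x dμ₀(x) > 0. Let λ > 0 and let μ_t = Σ_{n≥1} e^{−λt}(1−e^{−λt})^{n−1} μ₀^{*n} be the Wild sum. Then for every a ∈ ℝ there exists a constant κ > 0 such that for all t ≥ 0: e^{−λt} μ₀((−∞, a)) ≤ μ_t((−∞, a)) ≤ κ e^{−λt}. In particular, μ_t((−∞,a)) converges to zero exponentially at rate λ. -/
open MeasureTheory

/-- The Laplace transform turns convolution powers into powers. -/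
theorem lintegral_exp_mul_convPow (μ : Measure ℝ) [SFinite μ] (s : ℝ) (n : ℕ) :
    ∫⁻ x, ENNReal.ofReal (Real.exp (s * x)) ∂(convPow μ n) =
      (∫⁻ x, ENNReal.ofReal (Real.exp (s * x)) ∂μ) ^ n := by
  induction n with
  | zero => simp [convPow]
  | succ n ih =>
    rw [convPow, Measure.lintegral_conv (by fun_prop), pow_succ, ← ih,
      ← lintegral_mul_const _ (by fun_prop)]
    refine lintegral_congr fun x => ?_
    rw [← lintegral_const_mul _ (by fun_prop)]
    refine lintegral_congr fun y => ?_
    rw [mul_add, Real.exp_add, ENNReal.ofReal_mul (Real.exp_pos _).le]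

/-- Chernoff bound for the left tail. -/
theorem measure_Iio_le_exp_mul_lintegral (ν : Measure ℝ) {s : ℝ} (hs : s ≤ 0) (a : ℝ) :
    ν (Set.Iio a) ≤ ENNReal.ofReal (Real.exp (-(s * a))) *
      ∫⁻ x, ENNReal.ofReal (Real.exp (s * x)) ∂ν := by
  rw [← lintegral_const_mul _ (by fun_prop), ← lintegral_indicator_one measurableSet_Iio]
  refine lintegral_mono fun x => ?_
  refine Set.indicator_apply_le' (fun hx => ?_) (fun _ => zero_le)
  rw [Pi.one_apply]
  rw [← ENNReal.ofReal_mul (Real.exp_pos _).le, ← Real.exp_add]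
  refine ENNReal.one_le_ofReal.2 (Real.one_le_exp ?_)
  nlinarith [Set.mem_Iio.1 hx]

/-- A probability measure with exponential moments and positive mean has a Laplace transform
that is less than one at some negative argument. -/
theorem exists_neg_lintegral_exp_mul_lt_one (μ : Measure ℝ) [IsProbabilityMeasure μ]
    (hmgf : ∃ ε > (0 : ℝ), ∀ s : ℝ, |s| < ε → Integrable (fun x : ℝ => Real.exp (s * x)) μ)
    (hmean : 0 < ∫ x, x ∂μ) :
    ∃ s < (0 : ℝ), ∫⁻ x, ENNReal.ofReal (Real.exp (s * x)) ∂μ < 1 := by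
  obtain ⟨ε, hε, hint⟩ := hmgf
  have hball : Metric.ball (0 : ℝ) ε ⊆ ProbabilityTheory.integrableExpSet id μ := fun s hs =>
    hint s (by simpa using hs)
  have hmem : (0 : ℝ) ∈ interior (ProbabilityTheory.integrableExpSet id μ) :=
    mem_interior_iff_mem_nhds.2 (Filter.mem_of_superset (Metric.ball_mem_nhds 0 hε) hball)
  have hderiv : 0 < deriv (fun s => ProbabilityTheory.mgf id μ s - 1) 0 := by
    simpa [ProbabilityTheory.deriv_mgf_zero hmem] using hmean
  have hsign := eventually_nhdsWithin_sign_eq_of_deriv_pos hderiv (by simp)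
  have hnear : ∀ᶠ s in nhdsWithin (0 : ℝ) (Set.Iio 0), s ∈ Metric.ball (0 : ℝ) ε ∧ s < 0 ∧
      SignType.sign (ProbabilityTheory.mgf id μ s - 1) = SignType.sign (s - 0) :=
    (Filter.Eventually.filter_mono nhdsWithin_le_nhds (Metric.ball_mem_nhds 0 hε)).and
      (Filter.Eventually.and self_mem_nhdsWithin (Filter.Eventually.filter_mono nhdsWithin_le_nhds hsign))
  obtain ⟨s, hs, hs0, hsgn⟩ := hnear.exists
  refine ⟨s, hs0, ?_⟩
  rw [sub_zero, sign_neg hs0, sign_eq_neg_one_iff, sub_neg] at hsgn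
  rw [← ofReal_integral_eq_lintegral_ofReal (hint s (by simpa using hs))
    (.of_forall fun x => (Real.exp_pos _).le)]
  exact ENNReal.ofReal_lt_one.2 hsgn

theorem wildSum_apply (μ₀ : Measure ℝ) (lam t : ℝ) {A : Set ℝ} (hA : MeasurableSet A) :
    wildSum μ₀ lam t A = ∑' n : ℕ,
      ENNReal.ofReal (Real.exp (-(lam * t)) * (1 - Real.exp (-(lam * t))) ^ n) *
        convPow μ₀ (n + 1) A := by
  simp [wildSum, Measure.sum_apply _ hA]

theorem ofReal_exp_mul_le_wildSum (μ₀ : Measure ℝ) [SFinite μ₀] (lam t : ℝ) {A : Set ℝ}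
    (hA : MeasurableSet A) :
    ENNReal.ofReal (Real.exp (-(lam * t))) * μ₀ A ≤ wildSum μ₀ lam t A := by
  rw [wildSum_apply _ _ _ hA]
  simpa [convPow] using ENNReal.le_tsum (f := fun n : ℕ =>
      ENNReal.ofReal (Real.exp (-(lam * t)) * (1 - Real.exp (-(lam * t))) ^ n) *
        convPow μ₀ (n + 1) A) 0

theorem wildSum_Iio_le (μ₀ : Measure ℝ) [SFinite μ₀] {lam t s : ℝ} (ht : 0 ≤ lam * t)
    (hs : s ≤ 0) (hR : ∫⁻ x, ENNReal.ofReal (Real.exp (s * x)) ∂μ₀ ≤ 1) (a : ℝ) :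
    wildSum μ₀ lam t (Set.Iio a) ≤ ENNReal.ofReal (Real.exp (-(lam * t))) *
      (ENNReal.ofReal (Real.exp (-(s * a))) *
        (1 - ∫⁻ x, ENNReal.ofReal (Real.exp (s * x)) ∂μ₀)⁻¹) := by
  have hE : Real.exp (-(lam * t)) ≤ 1 := Real.exp_le_one_iff.2 (by linarith)
  rw [wildSum_apply _ _ _ measurableSet_Iio, ← ENNReal.tsum_geometric, ← ENNReal.tsum_mul_left,
    ← ENNReal.tsum_mul_left]
  refine ENNReal.tsum_le_tsum fun n => mul_le_mul' (ENNReal.ofReal_le_ofReal ?_) ?_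
  · exact mul_le_of_le_one_right (Real.exp_pos _).le
      (pow_le_one₀ (by linarith) (by linarith [Real.exp_pos (-(lam * t))]))
  · refine (measure_Iio_le_exp_mul_lintegral _ hs a).trans ?_
    rw [lintegral_exp_mul_convPow]
    exact mul_le_mul_right (pow_le_pow_right_of_le_one' hR n.le_succ) _

/-- **Proposition 2.** If `μ₀` has a moment generating function finite near `0`
and strictly positive mean, then for every `a` the Wild sum satisfies
`e^{−λt} μ₀((−∞,a)) ≤ μ_t((−∞,a)) ≤ κ e^{−λt}`; convergence to `0` is exponential at
rate `λ`. -/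
theorem wildSum_exponential_convergence
    (μ₀ : Measure ℝ) [IsProbabilityMeasure μ₀]
    (hmgf : ∃ ε > (0 : ℝ), ∀ s : ℝ, |s| < ε → Integrable (fun x : ℝ => Real.exp (s * x)) μ₀)
    (hmean : 0 < ∫ x, x ∂μ₀)
    (lam : ℝ) (hlam : 0 < lam) :
    ∀ a : ℝ, ∃ κ > (0 : ℝ), ∀ t ≥ (0 : ℝ),
      Real.exp (-(lam * t)) * (μ₀ (Set.Iio a)).toReal ≤
          ((wildSum μ₀ lam t) (Set.Iio a)).toReal ∧
        ((wildSum μ₀ lam t) (Set.Iio a)).toReal ≤ κ * Real.exp (-(lam * t)) := by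
  intro a
  obtain ⟨s, hs, hR⟩ := exists_neg_lintegral_exp_mul_lt_one μ₀ hmgf hmean
  set C : ENNReal := ENNReal.ofReal (Real.exp (-(s * a))) *
    (1 - ∫⁻ x, ENNReal.ofReal (Real.exp (s * x)) ∂μ₀)⁻¹ with hC
  have hC_top : C ≠ ⊤ :=
    ENNReal.mul_ne_top ENNReal.ofReal_ne_top (ENNReal.inv_ne_top.2 (tsub_pos_of_lt hR).ne')
  have hC_zero : C ≠ 0 :=
    mul_ne_zero (ENNReal.ofReal_pos.2 (Real.exp_pos _)).ne'
      (ENNReal.inv_ne_zero.2 (ENNReal.sub_ne_top ENNReal.one_ne_top))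
  refine ⟨C.toReal, ENNReal.toReal_pos hC_zero hC_top, fun t ht => ?_⟩
  have hupper := wildSum_Iio_le μ₀ (mul_nonneg hlam.le ht) hs.le hR.le a
  rw [← hC] at hupper
  have hbound_top : ENNReal.ofReal (Real.exp (-(lam * t))) * C ≠ ⊤ :=
    ENNReal.mul_ne_top ENNReal.ofReal_ne_top hC_top
  constructor
  · simpa [ENNReal.toReal_mul, (Real.exp_pos _).le] using
      ENNReal.toReal_mono (ne_top_of_le_ne_top hbound_top hupper)
        (ofReal_exp_mul_le_wildSum μ₀ lam t measurableSet_Iio)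
  · simpa [ENNReal.toReal_mul, (Real.exp_pos _).le, mul_comm] using
      ENNReal.toReal_mono hbound_top hupper
end
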